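/- arXiv:2006.04177 — 2 statements merged into one kernel-verified Lean document; each statement's English description precedes it below -/
import Mathlib

section
/- For every natural number n ≥ 1: n belongs to the upper Wythoff set U (i.e., n = ⌊i·φ²⌋ for some integer i ≥ 1) if and only if there exists a finite set S of integers, each at least 2, containing no two consecutive integers, with 2 ∈ S, such that n − 1 = Σ_{k ∈ S} F_k. (Equivalently: the Zeckendorf representation of n − 1 ends in the digits 01.) -/
noncomputable def phi : ℝ := (1 + Real.sqrt 5) / 2

/-- The lower Wythoff set `L = {⌊i·φ⌋ : i ≥ 1}`. -/
def lowerWythoff : Set ℕ := {n | ∃ i : ℕ, 1 ≤ i ∧ n = ⌊(i : ℝ) * phi⌋₊}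

/-- The upper Wythoff set `U = {⌊i·φ²⌋ : i ≥ 1}`. -/
def upperWythoff : Set ℕ := {n | ∃ i : ℕ, 1 ≤ i ∧ n = ⌊(i : ℝ) * phi ^ 2⌋₊}

open Real in
theorem phi_eq_goldenRatio : phi = goldenRatio := rfl

open Real in
/-- A finite sum of distinct powers of `ψ` lies strictly between the sums of all odd and of all
even powers. -/
theorem sum_goldenConj_pow_bounds (S : Finset ℕ) (a : ℕ) (hS : ∀ k ∈ S, a ≤ k) :
    -1 < ∑ k ∈ S, goldenConj ^ (k - a) ∧ ∑ k ∈ S, goldenConj ^ (k - a) < goldenRatio := by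
  have hinj : Set.InjOn (fun k => k - a) (S : Set ℕ) := fun x hx y hy h => by
    have := hS x hx
    have := hS y hy
    grind
  rw [← Finset.sum_image (f := fun k => goldenConj ^ k) hinj]
  generalize S.image (fun k => k - a) = T
  obtain ⟨N, hN⟩ := T.exists_nat_subset_range
  set ψ := goldenConj with hψ
  have hneg : ψ < 0 := goldenConj_neg
  have hgt : -1 < ψ := neg_one_lt_goldenConj
  have hsq : ψ ^ 2 = ψ + 1 := goldenConj_sq
  have hφ : goldenRatio = 1 - ψ := by linarith [goldenRatio_add_goldenConj]
  have habs : ∀ k, |ψ ^ k| = (-ψ) ^ k := fun k => by rw [abs_pow, abs_of_neg hneg]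
  have hfin : ∀ N : ℕ, (∑ k ∈ Finset.range N, ψ ^ k) * (1 - ψ) = 1 - ψ ^ N := fun N =>
    geom_sum_mul_neg ψ N
  have hfin' : ∀ N : ℕ, (∑ k ∈ Finset.range N, (-ψ) ^ k) * (1 + ψ) = 1 - (-ψ) ^ N := fun N => by
    simpa using geom_sum_mul_neg (-ψ) N
  have hu : ∑ k ∈ T, ψ ^ k ≤ ∑ k ∈ Finset.range N, ((-ψ) ^ k + ψ ^ k) / 2 :=
    (Finset.sum_le_sum fun k _ => by linarith [le_abs_self (ψ ^ k), habs k]).trans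
      (Finset.sum_le_sum_of_subset_of_nonneg hN fun k _ _ => by
        linarith [neg_abs_le (ψ ^ k), habs k])
  have hl : ∑ k ∈ T, -ψ ^ k ≤ ∑ k ∈ Finset.range N, ((-ψ) ^ k - ψ ^ k) / 2 :=
    (Finset.sum_le_sum fun k _ => by linarith [neg_abs_le (ψ ^ k), habs k]).trans
      (Finset.sum_le_sum_of_subset_of_nonneg hN fun k _ _ => by
        linarith [le_abs_self (ψ ^ k), habs k])
  rw [← Finset.sum_div, Finset.sum_add_distrib] at hu
  rw [← Finset.sum_div, Finset.sum_sub_distrib, Finset.sum_neg_distrib] at hl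
  have hA : ∑ k ∈ Finset.range N, (-ψ) ^ k = (1 - (-ψ) ^ N) * (2 - ψ) := by
    rw [← hfin' N]
    linear_combination (∑ k ∈ Finset.range N, (-ψ) ^ k) * hsq
  have hB : ∑ k ∈ Finset.range N, ψ ^ k = (1 - ψ ^ N) * (-ψ) := by
    rw [← hfin N]
    linear_combination (-∑ k ∈ Finset.range N, ψ ^ k) * hsq
  rw [hA, hB] at hu hl
  have hp : 0 < (-ψ) ^ N := pow_pos (by linarith) N
  have h1 : ψ ^ N ≤ (-ψ) ^ N := habs N ▸ le_abs_self _
  have h2 : -(-ψ) ^ N ≤ ψ ^ N := habs N ▸ neg_abs_le _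
  constructor <;> nlinarith

open Real in
theorem fib_eq_goldenRatio_sq_mul_fib_sub_two {k : ℕ} (hk : 2 ≤ k) :
    (Nat.fib k : ℝ) = goldenRatio ^ 2 * Nat.fib (k - 2) + goldenConj ^ (k - 2) := by
  obtain ⟨j, rfl⟩ := Nat.exists_eq_add_of_le' hk
  rw [Nat.add_sub_cancel, Nat.fib_add_two, goldenRatio_sq, ← fib_succ_sub_goldenRatio_mul_fib]
  push_cast
  ring

open Real in
theorem sum_fib_eq_goldenRatio_sq_mul (S : Finset ℕ) (hS : ∀ k ∈ S, 2 ≤ k) :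
    ((∑ k ∈ S, Nat.fib k : ℕ) : ℝ) =
      goldenRatio ^ 2 * (∑ k ∈ S, Nat.fib (k - 2) : ℕ) + ∑ k ∈ S, goldenConj ^ (k - 2) := by
  push_cast
  rw [Finset.mul_sum, ← Finset.sum_add_distrib]
  exact Finset.sum_congr rfl fun k hk => fib_eq_goldenRatio_sq_mul_fib_sub_two (hS k hk)

open Real in
theorem sum_goldenConj_pow_bounds_of_two_mem {S : Finset ℕ} (hS : ∀ k ∈ S, 2 ≤ k)
    (h2 : 2 ∈ S) (h3 : 3 ∉ S) :
    goldenRatio - 1 < ∑ k ∈ S, goldenConj ^ (k - 2) ∧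
      ∑ k ∈ S, goldenConj ^ (k - 2) < goldenRatio := by
  refine ⟨?_, (sum_goldenConj_pow_bounds S 2 hS).2⟩
  have h4 : ∀ k ∈ S.erase 2, 4 ≤ k := fun k hk => by
    obtain ⟨hk2, hkS⟩ := Finset.mem_erase.1 hk
    have := hS k hkS
    have : k ≠ 3 := fun h => h3 (h ▸ hkS)
    omega
  have hshift : ∑ k ∈ S.erase 2, goldenConj ^ (k - 2) =
      goldenConj ^ 2 * ∑ k ∈ S.erase 2, goldenConj ^ (k - 4) := by
    rw [Finset.mul_sum]
    refine Finset.sum_congr rfl fun k hk => ?_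
    rw [← pow_add]
    congr 1
    have := h4 k hk
    omega
  rw [← Finset.add_sum_erase S _ h2, hshift]
  have hb := (sum_goldenConj_pow_bounds _ 4 h4).1
  have hpos : 0 < goldenConj ^ 2 := sq_pos_of_neg goldenConj_neg
  rw [Nat.sub_self, pow_zero]
  nlinarith [goldenConj_sq, goldenRatio_add_goldenConj]

open Real in
theorem sum_goldenConj_pow_bounds_of_two_notMem {S : Finset ℕ} (hS : ∀ k ∈ S, 2 ≤ k)
    (h2 : 2 ∉ S) :
    -1 < ∑ k ∈ S, goldenConj ^ (k - 2) ∧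
      ∑ k ∈ S, goldenConj ^ (k - 2) < goldenRatio - 1 := by
  refine ⟨(sum_goldenConj_pow_bounds S 2 hS).1, ?_⟩
  have h3 : ∀ k ∈ S, 3 ≤ k := fun k hk => by
    have := hS k hk
    have : k ≠ 2 := fun h => h2 (h ▸ hk)
    omega
  have hshift : ∑ k ∈ S, goldenConj ^ (k - 2) =
      goldenConj * ∑ k ∈ S, goldenConj ^ (k - 3) := by
    rw [Finset.mul_sum]
    refine Finset.sum_congr rfl fun k hk => ?_
    rw [← pow_succ']
    congr 1
    have := h3 k hk
    omega
  rw [hshift]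
  have hb := (sum_goldenConj_pow_bounds _ 3 h3).1
  nlinarith [goldenConj_neg, goldenRatio_add_goldenConj]

theorem exists_finset_sum_fib_eq (m : ℕ) :
    ∃ S : Finset ℕ, (∀ k ∈ S, 2 ≤ k) ∧ (∀ k ∈ S, k + 1 ∉ S) ∧ m = ∑ k ∈ S, Nat.fib k := by
  have hrep := m.isZeckendorfRep_zeckendorf
  have hsum := m.sum_zeckendorf_fib
  generalize m.zeckendorf = l at hrep hsum
  have : IsTrans ℕ fun a b => b + 2 ≤ a := ⟨fun a b c _ _ => by omega⟩
  have hp : (l ++ [0]).Pairwise fun a b => b + 2 ≤ a := List.isChain_iff_pairwise.1 hrep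
  obtain ⟨hl, -, hz⟩ := List.pairwise_append.1 hp
  have hnd : l.Nodup := hl.imp fun h => by omega
  refine ⟨l.toFinset, fun k hk => ?_, fun k hk hk' => ?_, ?_⟩
  · simpa using hz k (List.mem_toFinset.1 hk) 0 (by simp)
  · have : Std.Symm fun a b : ℕ => b + 2 ≤ a ∨ a + 2 ≤ b := ⟨fun _ _ => Or.symm⟩
    have := (hl.imp (S := fun a b => b + 2 ≤ a ∨ a + 2 ≤ b) Or.inl).forall
      (List.mem_toFinset.1 hk) (List.mem_toFinset.1 hk') (by omega)
    omega
  · rw [List.sum_toFinset _ hnd, hsum]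

open Real in
theorem natCast_ne_goldenRatio_sq_mul (n : ℕ) {i : ℕ} (hi : 1 ≤ i) :
    (n : ℝ) ≠ i * goldenRatio ^ 2 := by
  have h : Irrational (i * (goldenRatio + (1 : ℕ)) : ℝ) :=
    (goldenRatio_irrational.add_natCast 1).natCast_mul (by omega)
  rw [goldenRatio_sq]
  exact_mod_cast (h.ne_nat n).symm

/-- `n ∈ U` iff the Zeckendorf representation of `n - 1` ends in digits 01,
i.e., `n - 1` is a sum of non-consecutive Fibonacci numbers with indices ≥ 2,
one of which is `F_2`. -/
theorem upper_wythoff_iff_zeckendorf_ends_in_zero_one (n : ℕ) (hn : 1 ≤ n) :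
    n ∈ upperWythoff ↔
      ∃ S : Finset ℕ, (∀ k ∈ S, 2 ≤ k) ∧ (∀ k ∈ S, k + 1 ∉ S) ∧ 2 ∈ S ∧
        n - 1 = ∑ k ∈ S, Nat.fib k := by
  have hcast : ((n - 1 : ℕ) : ℝ) = n - 1 := by push_cast [hn]; ring
  have hsq := Real.goldenRatio_sq
  have hpos := Real.goldenRatio_pos
  constructor
  · rintro ⟨i, hi, hni⟩
    obtain ⟨S, hS, hcons, hsum⟩ := exists_finset_sum_fib_eq (n - 1)
    refine ⟨S, hS, hcons, ?_, hsum⟩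
    by_contra h2
    obtain ⟨hlo, hhi⟩ := sum_goldenConj_pow_bounds_of_two_notMem hS h2
    have hfib := sum_fib_eq_goldenRatio_sq_mul S hS
    rw [← hsum, hcast] at hfib
    rw [phi_eq_goldenRatio] at hni
    obtain ⟨hle, hlt⟩ := (Nat.floor_eq_iff (by positivity)).1 hni.symm
    have hne := hle.lt_of_ne (natCast_ne_goldenRatio_sq_mul n hi)
    generalize ∑ k ∈ S, Nat.fib (k - 2) = j at hfib
    have h1 : (j : ℝ) < i := by nlinarith
    have h2 : (i : ℝ) < j + 1 := by nlinarith
    norm_cast at h1 h2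
    omega
  · rintro ⟨S, hS, hcons, h2, hsum⟩
    obtain ⟨hlo, hhi⟩ := sum_goldenConj_pow_bounds_of_two_mem hS h2 (hcons 2 h2)
    have hfib := sum_fib_eq_goldenRatio_sq_mul S hS
    rw [← hsum, hcast] at hfib
    refine ⟨∑ k ∈ S, Nat.fib (k - 2) + 1, Nat.le_add_left .., ?_⟩
    rw [phi_eq_goldenRatio, eq_comm, Nat.floor_eq_iff (by positivity)]
    generalize ∑ k ∈ S, Nat.fib (k - 2) = j at hfib
    push_cast
    constructor <;> nlinarith
end

section
/- The sumset L + U + U equals ℕ \ {0, 1, 2, 3, 4, 6, 9}; that is, a natural number n can be written as n = a + b + c with a ∈ L and b, c ∈ U if and only if n ∉ {0, 1, 2, 3, 4, 6, 9}. -/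
theorem phi_sq : phi ^ 2 = phi + 1 := by
  have h : Real.sqrt 5 ^ 2 = 5 := Real.sq_sqrt (by norm_num)
  unfold phi
  linear_combination h / 4

theorem lt_phi : 1.618 < phi := by
  have h : (2.236 : ℝ) < Real.sqrt 5 := Real.lt_sqrt_of_sq_lt (by norm_num)
  unfold phi
  linarith

theorem phi_lt : phi < 1.6181 := by
  have h : Real.sqrt 5 < 2.2362 := (Real.sqrt_lt' (by norm_num)).2 (by norm_num)
  unfold phi
  linarith

theorem mem_lowerWythoff_iff {a : ℕ} :
    a ∈ lowerWythoff ↔ ∃ i : ℕ, 1 ≤ i ∧ (a : ℝ) ≤ i * phi ∧ (i : ℝ) * phi < a + 1 := by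
  have h := lt_phi
  refine exists_congr fun i => and_congr_right fun _ => ?_
  rw [eq_comm, Nat.floor_eq_iff (by positivity)]

theorem mem_upperWythoff_iff {a : ℕ} :
    a ∈ upperWythoff ↔
      ∃ i : ℕ, 1 ≤ i ∧ (a : ℝ) ≤ i * (phi + 1) ∧ (i : ℝ) * (phi + 1) < a + 1 := by
  have h := lt_phi
  refine exists_congr fun i => and_congr_right fun _ => ?_
  rw [eq_comm, phi_sq, Nat.floor_eq_iff (by positivity)]

/-- If a positive integer is not in the lower Wythoff set, then adding `4` moves it there. -/
theorem mem_lowerWythoff_or_add_four {m : ℕ} (hm : 1 ≤ m) :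
    m ∈ lowerWythoff ∨ m + 4 ∈ lowerWythoff := by
  have h1 := lt_phi
  have h2 := phi_lt
  have h3 := phi_sq
  simp only [mem_lowerWythoff_iff]
  have hx : (0 : ℝ) ≤ m * (phi - 1) := mul_nonneg (by positivity) (by linarith)
  obtain ⟨k, hk⟩ : ∃ k, k = ⌊(m : ℝ) * (phi - 1)⌋₊ := ⟨_, rfl⟩
  have hk1 : (k : ℝ) ≤ m * (phi - 1) := hk ▸ Nat.floor_le hx
  have hk2 : (m : ℝ) * (phi - 1) < k + 1 := hk ▸ Nat.lt_floor_add_one _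
  have hmul : (m : ℝ) * (phi - 1) * phi = m := by linear_combination (m : ℝ) * h3
  have hk1' := mul_le_mul_of_nonneg_right hk1 (by linarith : (0 : ℝ) ≤ phi)
  have hk2' := mul_lt_mul_of_pos_right hk2 (by linarith : (0 : ℝ) < phi)
  rw [hmul] at hk1' hk2'
  by_cases h : ((k : ℝ) + 1) * phi < m + 1
  · exact Or.inl ⟨k + 1, by omega, by push_cast; linarith, by push_cast; linarith⟩
  · exact Or.inr ⟨k + 3, by omega, by push_cast; linarith, by push_cast; linarith⟩

theorem lowerWythoff_ne {a : ℕ} (ha : a ∈ lowerWythoff) : a ≠ 0 ∧ a ≠ 2 ∧ a ≠ 5 := by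
  have h1 := lt_phi
  have h2 := phi_lt
  obtain ⟨i, hi, hl, hr⟩ := mem_lowerWythoff_iff.1 ha
  have hi4 : i < 4 ∨ 4 ≤ i := lt_or_ge i 4
  rcases hi4 with hi4 | hi4
  · refine ⟨?_, ?_, ?_⟩ <;> rintro rfl <;> interval_cases i <;> norm_num at hl hr <;> linarith
  · have hi4' : (4 : ℝ) ≤ i := by exact_mod_cast hi4
    have ha5 : (5 : ℝ) < a := by nlinarith
    have : 5 < a := by exact_mod_cast ha5
    omega

theorem upperWythoff_eq_or {b : ℕ} (hb : b ∈ upperWythoff) : b = 2 ∨ b = 5 ∨ 7 ≤ b := by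
  have h1 := lt_phi
  have h2 := phi_lt
  obtain ⟨i, hi, hl, hr⟩ := mem_upperWythoff_iff.1 hb
  rcases lt_or_ge i 3 with hi3 | hi3
  · have hlt : b < 6 := by
      have : (i : ℝ) ≤ 2 := by exact_mod_cast (by omega : i ≤ 2)
      have : (b : ℝ) < 6 := by nlinarith
      exact_mod_cast this
    interval_cases i <;> interval_cases b <;> norm_num at hl hr ⊢ <;> linarith
  · have hi3' : (3 : ℝ) ≤ i := by exact_mod_cast hi3
    have hb6 : (6 : ℝ) < b := by nlinarith
    have : 6 < b := by exact_mod_cast hb6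
    omega

/-- Theorem 3.7(i): `L + U + U = ℕ \ {0, 1, 2, 3, 4, 6, 9}`. -/
theorem lower_add_upper_add_upper (n : ℕ) :
    (∃ a ∈ lowerWythoff, ∃ b ∈ upperWythoff, ∃ c ∈ upperWythoff, n = a + b + c) ↔
      n ∉ ({0, 1, 2, 3, 4, 6, 9} : Set ℕ) := by
  have h1 := lt_phi
  have h2 := phi_lt
  simp only [Set.mem_insert_iff, Set.mem_singleton_iff]
  constructor
  · rintro ⟨a, ha, b, hb, c, hc, rfl⟩
    have ha' := lowerWythoff_ne ha
    have hb' := upperWythoff_eq_or hb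
    have hc' := upperWythoff_eq_or hc
    omega
  · intro hn
    have lower {a : ℕ} (i : ℕ) (hi : 1 ≤ i) (hl : (a : ℝ) ≤ i * phi)
        (hr : (i : ℝ) * phi < a + 1) : a ∈ lowerWythoff :=
      mem_lowerWythoff_iff.2 ⟨i, hi, hl, hr⟩
    have upper {a : ℕ} (i : ℕ) (hi : 1 ≤ i) (hl : (a : ℝ) ≤ i * (phi + 1))
        (hr : (i : ℝ) * (phi + 1) < a + 1) : a ∈ upperWythoff :=
      mem_upperWythoff_iff.2 ⟨i, hi, hl, hr⟩
    have u2 : 2 ∈ upperWythoff := by apply upper 1 <;> norm_num <;> linarith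
    have u5 : 5 ∈ upperWythoff := by apply upper 2 <;> norm_num <;> linarith
    have u7 : 7 ∈ upperWythoff := by apply upper 3 <;> norm_num <;> linarith
    rcases lt_or_ge n 15 with h | h
    · have l1 : 1 ∈ lowerWythoff := by apply lower 1 <;> norm_num <;> linarith
      have l3 : 3 ∈ lowerWythoff := by apply lower 2 <;> norm_num <;> linarith
      have l4 : 4 ∈ lowerWythoff := by apply lower 3 <;> norm_num <;> linarith
      have l6 : 6 ∈ lowerWythoff := by apply lower 4 <;> norm_num <;> linarith
      have l8 : 8 ∈ lowerWythoff := by apply lower 5 <;> norm_num <;> linarith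
      have l9 : 9 ∈ lowerWythoff := by apply lower 6 <;> norm_num <;> linarith
      obtain rfl | rfl | rfl | rfl | rfl | rfl | rfl | rfl :
          n = 5 ∨ n = 7 ∨ n = 8 ∨ n = 10 ∨ n = 11 ∨ n = 12 ∨ n = 13 ∨ n = 14 := by omega
      · exact ⟨1, l1, 2, u2, 2, u2, rfl⟩
      · exact ⟨3, l3, 2, u2, 2, u2, rfl⟩
      · exact ⟨4, l4, 2, u2, 2, u2, rfl⟩
      · exact ⟨6, l6, 2, u2, 2, u2, rfl⟩
      · exact ⟨4, l4, 2, u2, 5, u5, rfl⟩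
      · exact ⟨8, l8, 2, u2, 2, u2, rfl⟩
      · exact ⟨9, l9, 2, u2, 2, u2, rfl⟩
      · exact ⟨4, l4, 5, u5, 5, u5, rfl⟩
    · obtain ⟨m, rfl⟩ := Nat.exists_eq_add_of_le h
      rcases mem_lowerWythoff_or_add_four (m := m + 1) (by omega) with hl | hl
      · exact ⟨_, hl, 7, u7, 7, u7, by omega⟩
      · exact ⟨_, hl, 5, u5, 5, u5, by omega⟩
end
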